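/- Let Z = T^{(p)}[(S_n, θ_n)_{n∈ℕ}] be a regular p-convexified mixed Tsirelson space, 1 ≤ p < ∞, such that θ_n/θ^n → 0, where θ = lim_n θ_n^{1/n}. Then the unit vector basis of T^{(p)}_θ ω-strongly dominates the unit vector basis of Z. -/

import Mathlib

open Finset Filter


/-- The minimum of a finite set of naturals (0 for the empty set). -/
noncomputable def fmin (s : Finset ℕ) : ℕ := sInf (s : Set ℕ)

/-- The Schreier families `S_n`, `n ∈ ℕ`. -/
def SchreierNat : ℕ → Set (Finset ℕ)
  | 0 => {F | F.card ≤ 1}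
  | n + 1 => {F | ∃ (k : ℕ) (E : Fin k → Finset ℕ),
      (∀ i, E i ∈ SchreierNat n) ∧
      (∀ i j : Fin k, i < j → ∀ a ∈ E i, ∀ b ∈ E j, a < b) ∧
      (∀ i, ∀ a ∈ E i, k ≤ a) ∧
      F = Finset.univ.biUnion E}

/-- The Schreier family `S_ω`, defined using the sequence `n ↗ ω`. -/
def SchreierOmega : Set (Finset ℕ) :=
  {F | ∃ n : ℕ, F ∈ SchreierNat n ∧ ∀ a ∈ F, n ≤ a}

/-- A finite sequence `E 0 < E 1 < … < E (k-1)` of nonempty finite subsets of `ℕ` is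
`𝒮`-admissible if the set of minima belongs to `𝒮`. -/
def SAdmissible (𝒮 : Set (Finset ℕ)) {k : ℕ} (E : Fin k → Finset ℕ) : Prop :=
  (∀ i, (E i).Nonempty) ∧
  (∀ i j : Fin k, i < j → ∀ a ∈ E i, ∀ b ∈ E j, a < b) ∧
  Finset.image (fun i => fmin (E i)) Finset.univ ∈ 𝒮

/-- Restriction `E x` of a finitely supported vector `x` to a set `E` of coordinates. -/
noncomputable def restr (E : Finset ℕ) (x : ℕ →₀ ℝ) : ℕ →₀ ℝ :=
  Finsupp.filter (· ∈ E) x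

/-- The sup norm `‖x‖_∞` of a finitely supported vector. -/
noncomputable def fsupNorm (x : ℕ →₀ ℝ) : ℝ := ⨆ i, |x i|

/-- `Tn` is (a norm satisfying the implicit equation of) the `p`-convexified mixed
Tsirelson space `T^{(p)}[(S_n, θ_n)_{n ∈ N}]`, as a function on `c₀₀`. -/
def IsMixedTsirelsonNorm (p : ℝ) (N : Set ℕ) (θ : ℕ → ℝ) (Tn : (ℕ →₀ ℝ) → ℝ) : Prop :=
  ∀ x : ℕ →₀ ℝ,
    Tn x = max (fsupNorm x)
      (sSup {r : ℝ | ∃ n ∈ N, ∃ (k : ℕ) (E : Fin k → Finset ℕ),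
        SAdmissible (SchreierNat n) E ∧
        r = θ n ^ (1 / p) * (∑ i, Tn (restr (E i) x) ^ p) ^ (1 / p)})

/-- `Tn` is (a norm satisfying the implicit equation of) the `p`-convexified
Tsirelson-type space `T^{(p)}[S₁, θ] = T^{(p)}_θ`, as a function on `c₀₀`. -/
def IsT1Norm (p θ : ℝ) (Tn : (ℕ →₀ ℝ) → ℝ) : Prop :=
  IsMixedTsirelsonNorm p {1} (fun _ => θ) Tn

/-- Regularity of the sequence of parameters: `(θ_n) ⊂ (0,1)`, `θ_n ↘ 0` and
`θ_{n+m} ≥ θ_n θ_m`. -/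
def RegularParams (θ : ℕ → ℝ) : Prop :=
  (∀ n, 0 < θ n ∧ θ n < 1) ∧ Antitone θ ∧
    Tendsto θ atTop (nhds 0) ∧ ∀ n m, θ n * θ m ≤ θ (n + m)

section VecCore

variable {Y : Type*} [NormedAddCommGroup Y] [NormedSpace ℝ Y]

/-- The vector `∑_i a_i y_i` determined by finitely many coefficients. -/
noncomputable def vec (y : ℕ → Y) (a : ℕ →₀ ℝ) : Y := a.sum fun i c => c • y i

/-- `x` is a basic sequence: nonzero vectors satisfying the Grunblum criterion. -/
def IsBasicSeq (x : ℕ → Y) : Prop :=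
  (∀ i, x i ≠ 0) ∧
  ∃ C : ℝ, 1 ≤ C ∧ ∀ (a : ℕ → ℝ) (n m : ℕ), n ≤ m →
    ‖∑ i ∈ Finset.range n, a i • x i‖ ≤ C * ‖∑ i ∈ Finset.range m, a i • x i‖

/-- A seminormalized sequence. -/
def Seminormalized (x : ℕ → Y) : Prop :=
  ∃ c C : ℝ, 0 < c ∧ ∀ i, c ≤ ‖x i‖ ∧ ‖x i‖ ≤ C

/-- `𝒮`-unconditionality of a sequence, for a family `𝒮` of finite subsets of `ℕ`. -/
def FUnconditional (𝒮 : Set (Finset ℕ)) (x : ℕ → Y) : Prop :=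
  ∃ C : ℝ, 1 ≤ C ∧ ∀ (a : ℕ →₀ ℝ), ∀ F ∈ 𝒮,
    ‖∑ i ∈ F, a i • x i‖ ≤ C * ‖vec x a‖

/-- An unconditional sequence. -/
def UnconditionalSeq (x : ℕ → Y) : Prop :=
  ∃ C : ℝ, 1 ≤ C ∧ ∀ (a : ℕ →₀ ℝ) (F : Finset ℕ),
    ‖∑ i ∈ F, a i • x i‖ ≤ C * ‖vec x a‖

/-- The closed linear span `[y_i]` contains an isomorphic copy of `c₀`: it contains a
sequence equivalent to the unit vector basis of `c₀`. -/
def SpanContainsC0 (y : ℕ → Y) : Prop :=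
  ∃ z : ℕ → Y, (∀ k, z k ∈ closure (Submodule.span ℝ (Set.range y) : Set Y)) ∧
    ∃ c C : ℝ, 0 < c ∧ ∀ a : ℕ →₀ ℝ,
      c * (⨆ i, |a i|) ≤ ‖vec z a‖ ∧ ‖vec z a‖ ≤ C * (⨆ i, |a i|)

/-- `[y_i]` contains the spaces `c₀ⁿ` uniformly: there is `C ≥ 1` such that for every
`n` there are `n` disjointly supported vectors `C`-equivalent to the unit vector
basis of `c₀ⁿ`. -/
def ContainsC0nUniformly (y : ℕ → Y) : Prop :=
  ∃ C : ℝ, 1 ≤ C ∧ ∀ n : ℕ, ∃ b : Fin n → (ℕ →₀ ℝ),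
    (∀ j k, j ≠ k → Disjoint (b j).support (b k).support) ∧
    ∀ a : Fin n → ℝ,
      (1 / C) * (⨆ j, |a j|) ≤ ‖∑ j, a j • vec y (b j)‖ ∧
      ‖∑ j, a j • vec y (b j)‖ ≤ C * (⨆ j, |a j|)

/-- `e` is a (Schauder) basis of `Y`: nonzero vectors satisfying the Grunblum
criterion whose linear span is dense. -/
def IsSchauderBasis (e : ℕ → Y) : Prop :=
  (∀ i, e i ≠ 0) ∧
  (∃ C : ℝ, 1 ≤ C ∧ ∀ (a : ℕ → ℝ) (n m : ℕ), n ≤ m →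
    ‖∑ i ∈ Finset.range n, a i • e i‖ ≤ C * ‖∑ i ∈ Finset.range m, a i • e i‖) ∧
  Dense (Submodule.span ℝ (Set.range e) : Set Y)

/-- A family of finitely supported coefficient vectors is a block family:
nonempty successive supports. -/
def SuccBlocks {ι : Type*} [Preorder ι] (A : ι → (ℕ →₀ ℝ)) : Prop :=
  (∀ i, (A i).support.Nonempty) ∧
  ∀ i j, i < j → ∀ a ∈ (A i).support, ∀ b ∈ (A j).support, a < b

end VecCore

section CBStar

/-- Indicator function of a finite set, as an element of the Cantor space `ℕ → Bool`. -/
def finsetToFun (F : Finset ℕ) : ℕ → Bool := fun n => if n ∈ F then true else false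

/-- The iterated Cantor–Bendixson derivative of a subset of the Cantor space. -/
noncomputable def cbIter (S : Set (ℕ → Bool)) (o : Ordinal) : Set (ℕ → Bool) :=
  Ordinal.limitRecOn o S (fun _ ih => {x | x ∈ ih ∧ AccPt x (Filter.principal ih)})
    (fun o _ ih => ⋂ b : {b : Ordinal // b < o}, ih b.1 b.2)

/-- The Cantor–Bendixson index of a family of finite subsets of `ℕ`, viewed as a
subset of the Cantor space via indicator functions. -/
noncomputable def CBIndex (𝒜 : Set (Finset ℕ)) : Ordinal :=
  sInf {o : Ordinal | cbIter (finsetToFun '' 𝒜) o = ∅}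

/-- A regular family of finite subsets of `ℕ`: hereditary, spreading and compact. -/
def IsRegularFamily (𝒜 : Set (Finset ℕ)) : Prop :=
  (∀ F ∈ 𝒜, ∀ G ⊆ F, G ∈ 𝒜) ∧
  (∀ F ∈ 𝒜, ∀ f : ℕ → ℕ, (∀ i ∈ F, ∀ j ∈ F, i < j → f i < f j) →
    (∀ i ∈ F, i ≤ f i) → F.image f ∈ 𝒜) ∧
  IsCompact (finsetToFun '' 𝒜)

/-- The scale of families appearing in conditions (★) and (▲): countable regular
families, increasing, with Cantor–Bendixson indices increasing to `ω^α`. -/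
def GoodScale (α : Ordinal) (𝒻 : ℕ → Set (Finset ℕ)) : Prop :=
  (∀ n, (𝒻 n).Countable ∧ IsRegularFamily (𝒻 n)) ∧
  (∀ n, 𝒻 n ⊆ 𝒻 (n + 1)) ∧
  (∀ n, CBIndex (𝒻 n) < Ordinal.omega0 ^ α) ∧
  (∀ β, β < Ordinal.omega0 ^ α → ∃ n, β < CBIndex (𝒻 n))

variable {X Y : Type*} [NormedAddCommGroup X] [NormedSpace ℝ X]
  [NormedAddCommGroup Y] [NormedSpace ℝ Y]

/-- Condition (★) for the pair `(x_i)`, `(y_i)`: there is a scale `(𝒻_n)` of regular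
families with `CB(𝒻_n) ↗ ω^α` such that `Δ_n → 0`. -/
def StarCond (α : Ordinal) (x : ℕ → X) (y : ℕ → Y) : Prop :=
  ∃ 𝒻 : ℕ → Set (Finset ℕ), GoodScale α 𝒻 ∧
    ∀ ε : ℝ, 0 < ε → ∃ n₀ : ℕ, ∀ n, n₀ ≤ n → ∀ a : ℕ →₀ ℝ,
      (∀ F ∈ 𝒻 n, ‖∑ i ∈ F, a i • y i‖ ≤ (1 / 2) ^ n) →
      ‖vec y a‖ ≤ 1 → ‖vec x a‖ ≤ ε

/-- Condition (▲) for the pair `(x_i)`, `(y_i)`: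
`‖∑ a_i x_i‖ ≤ max_n 2^{-n} max_{n ≤ F ∈ 𝒻_n} ‖∑_{i∈F} a_i y_i‖`. -/
def TriangleCond (α : Ordinal) (x : ℕ → X) (y : ℕ → Y) : Prop :=
  ∃ 𝒻 : ℕ → Set (Finset ℕ), GoodScale α 𝒻 ∧
    ∀ a : ℕ →₀ ℝ, ∃ (n : ℕ) (F : Finset ℕ), F ∈ 𝒻 n ∧ (∀ i ∈ F, n ≤ i) ∧
      ‖vec x a‖ ≤ (1 / 2) ^ n * ‖∑ i ∈ F, a i • y i‖

/-- `(y_i)` α-strongly dominates `(x_i)` (relative to the Schreier family `𝒮α`):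
`(y_i)` is `S_α`-unconditional, `[y_i]` does not contain `c₀`, and the pair
`(x_i)`, `(y_i)` satisfies condition (★). -/
def StronglyDominates (α : Ordinal) (𝒮α : Set (Finset ℕ)) (y : ℕ → Y) (x : ℕ → X) : Prop :=
  FUnconditional 𝒮α y ∧ ¬ SpanContainsC0 y ∧ StarCond α x y

end CBStar

section NormStar

/-- Condition (★) with `α = ω` for the unit vector bases of two norms on `c₀₀`
(the `x`-sequence is the unit vector basis of `Tx`, the `y`-sequence the unit
vector basis of `Ty`). -/
def StarCondNorms (Tx Ty : (ℕ →₀ ℝ) → ℝ) : Prop :=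
  ∃ 𝒻 : ℕ → Set (Finset ℕ), GoodScale Ordinal.omega0.{0} 𝒻 ∧
    ∀ ε : ℝ, 0 < ε → ∃ n₀ : ℕ, ∀ n, n₀ ≤ n → ∀ a : ℕ →₀ ℝ,
      (∀ F ∈ 𝒻 n, Ty (restr F a) ≤ (1 / 2) ^ n) → Ty a ≤ 1 → Tx a ≤ ε

/-- `S_ω`-unconditionality of the unit vector basis of a norm on `c₀₀`. -/
def NormSOmegaUnconditional (Tn : (ℕ →₀ ℝ) → ℝ) : Prop :=
  ∃ C : ℝ, 1 ≤ C ∧ ∀ a : ℕ →₀ ℝ, ∀ F ∈ SchreierOmega, Tn (restr F a) ≤ C * Tn a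

/-- The completion of `(c₀₀, Tn)` contains an isomorphic copy of `c₀`: some
sequence in it is equivalent to the unit vector basis of `c₀`. -/
def NormContainsC0 (Tn : (ℕ →₀ ℝ) → ℝ) : Prop :=
  ∃ b : ℕ → (ℕ →₀ ℝ), ∃ c C : ℝ, 0 < c ∧ ∀ γ : ℕ →₀ ℝ,
    c * (⨆ k, |γ k|) ≤ Tn (γ.sum fun k t => t • b k) ∧
    Tn (γ.sum fun k t => t • b k) ≤ C * (⨆ k, |γ k|)

/-- The unit vector basis of `Ty` ω-strongly dominates the unit vector basis of
`Tx`: it is `S_ω`-unconditional, its span does not contain `c₀`, and the pair of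
unit vector bases satisfies (★) with `α = ω`. -/
def OmegaStrongDomNorms (Ty Tx : (ℕ →₀ ℝ) → ℝ) : Prop :=
  NormSOmegaUnconditional Ty ∧ ¬ NormContainsC0 Ty ∧ StarCondNorms Tx Ty

end NormStar

section Restriction

lemma restr_apply (E : Finset ℕ) (x : ℕ →₀ ℝ) (i : ℕ) :
    restr E x i = if i ∈ E then x i else 0 := by
  classical
  simp [restr, Finsupp.filter_apply]

lemma restr_restr (E F : Finset ℕ) (x : ℕ →₀ ℝ) : restr E (restr F x) = restr (E ∩ F) x := by
  ext i
  by_cases h1 : i ∈ E <;> by_cases h2 : i ∈ F <;> simp [restr_apply, h1, h2]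

lemma restr_restr_of_subset {E F : Finset ℕ} (h : E ⊆ F) (x : ℕ →₀ ℝ) :
    restr E (restr F x) = restr E x := by
  rw [restr_restr, Finset.inter_eq_left.2 h]

@[simp] lemma restr_empty (x : ℕ →₀ ℝ) : restr ∅ x = 0 := by
  ext i
  simp [restr_apply]

@[simp] lemma restr_zero (E : Finset ℕ) : restr E 0 = 0 := by
  ext i
  simp [restr_apply]

lemma restr_inter_support (E : Finset ℕ) (x : ℕ →₀ ℝ) :
    restr (E ∩ x.support) x = restr E x := by
  ext i
  by_cases h : x i = 0 <;> simp [restr_apply, h]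

lemma abs_le_fsupNorm (x : ℕ →₀ ℝ) (i : ℕ) : |x i| ≤ fsupNorm x := by
  refine le_ciSup (f := fun i => |x i|) ⟨∑ j ∈ x.support, |x j|, ?_⟩ i
  rintro _ ⟨j, rfl⟩
  by_cases h : x j = 0
  · simpa [h] using Finset.sum_nonneg fun k _ => abs_nonneg (x k)
  · exact Finset.single_le_sum (f := fun k => |x k|) (fun k _ => abs_nonneg _)
      (Finsupp.mem_support_iff.2 h)

lemma fsupNorm_le {x : ℕ →₀ ℝ} {b : ℝ} (h : ∀ i, |x i| ≤ b) : fsupNorm x ≤ b :=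
  ciSup_le h

lemma fsupNorm_nonneg (x : ℕ →₀ ℝ) : 0 ≤ fsupNorm x :=
  (abs_nonneg _).trans (abs_le_fsupNorm x 0)

@[simp] lemma fsupNorm_zero : fsupNorm 0 = 0 := by
  simp [fsupNorm]

lemma exists_fsupNorm_eq (x : ℕ →₀ ℝ) : ∃ i, fsupNorm x = |x i| := by
  obtain hs | hs := x.support.eq_empty_or_nonempty
  · refine ⟨0, ?_⟩
    rw [Finsupp.support_eq_empty.1 hs]
    simp
  · obtain ⟨i, -, hi⟩ := Finset.exists_max_image x.support (fun i => |x i|) hs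
    refine ⟨i, le_antisymm (fsupNorm_le fun j => ?_) (abs_le_fsupNorm x i)⟩
    by_cases hj : x j = 0
    · simp [hj]
    · exact hi j (Finsupp.mem_support_iff.2 hj)

end Restriction

section Schreier

/-- The members of a finite family are pairwise successive: `E 0 < E 1 < ⋯`. -/
def Successive {k : ℕ} (E : Fin k → Finset ℕ) : Prop :=
  ∀ i j : Fin k, i < j → ∀ a ∈ E i, ∀ b ∈ E j, a < b

lemma Successive.inter {k : ℕ} {E : Fin k → Finset ℕ} (h : Successive E) (F : Finset ℕ) :
    Successive fun i => E i ∩ F := fun i j hij a ha b hb =>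
  h i j hij a (Finset.mem_inter.1 ha).1 b (Finset.mem_inter.1 hb).1

lemma Successive.disjoint {k : ℕ} {E : Fin k → Finset ℕ} (h : Successive E) {i j : Fin k}
    (hij : i ≠ j) : Disjoint (E i) (E j) := by
  rw [Finset.disjoint_left]
  intro a ha hb
  obtain h' | h' := lt_or_gt_of_ne hij
  · exact lt_irrefl _ (h i j h' a ha a hb)
  · exact lt_irrefl _ (h j i h' a hb a ha)

lemma fmin_mem {s : Finset ℕ} (hs : s.Nonempty) : fmin s ∈ s :=
  Nat.sInf_mem (s := (s : Set ℕ)) hs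

lemma fmin_le {s : Finset ℕ} {a : ℕ} (ha : a ∈ s) : fmin s ≤ a :=
  Nat.sInf_le (s := (s : Set ℕ)) ha

lemma SAdmissible.fmin_lt {𝒮 : Set (Finset ℕ)} {k : ℕ} {E : Fin k → Finset ℕ}
    (h : SAdmissible 𝒮 E) {i j : Fin k} (hij : i < j) : fmin (E i) < fmin (E j) :=
  h.2.1 i j hij _ (fmin_mem (h.1 i)) _ (fmin_mem (h.1 j))

lemma SAdmissible.fmin_injective {𝒮 : Set (Finset ℕ)} {k : ℕ} {E : Fin k → Finset ℕ}
    (h : SAdmissible 𝒮 E) : Function.Injective fun i => fmin (E i) :=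
  (show StrictMono fun i => fmin (E i) from fun _ _ hij => h.fmin_lt hij).injective

lemma mem_schreierNat_one {F : Finset ℕ} :
    F ∈ SchreierNat 1 ↔ ∀ a ∈ F, F.card ≤ a := by
  constructor
  · rintro ⟨k, E, hE, -, hk, rfl⟩ a ha
    obtain ⟨i, -, hi⟩ := Finset.mem_biUnion.1 ha
    calc (Finset.univ.biUnion E).card ≤ ∑ i, (E i).card := Finset.card_biUnion_le
      _ ≤ ∑ _i : Fin k, 1 := Finset.sum_le_sum fun i _ => hE i
      _ = k := by simp
      _ ≤ a := hk i a hi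
  · intro h
    refine ⟨F.card, fun i => {F.orderEmbOfFin rfl i}, fun i => ?_, fun i j hij a ha b hb => ?_,
      fun i a ha => ?_, ?_⟩
    · simp [SchreierNat]
    · rw [Finset.mem_singleton.1 ha, Finset.mem_singleton.1 hb]
      exact (F.orderEmbOfFin rfl).strictMono hij
    · rw [Finset.mem_singleton.1 ha]
      exact h _ (Finset.orderEmbOfFin_mem F rfl i)
    · ext a
      have := Set.ext_iff.1 (Finset.range_orderEmbOfFin F rfl) a
      simp only [Set.mem_range, Finset.mem_coe] at this
      simp [← this, eq_comm]

lemma SAdmissible.le_of_mem {k : ℕ} {E : Fin k → Finset ℕ} (h : SAdmissible (SchreierNat 1) E)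
    (i : Fin k) {a : ℕ} (ha : a ∈ E i) : k ≤ a := by
  have := mem_schreierNat_one.1 h.2.2 (fmin (E i)) (Finset.mem_image_of_mem _ (Finset.mem_univ i))
  rw [Finset.card_image_of_injective _ h.fmin_injective] at this
  simpa using this.trans (fmin_le ha)

lemma sAdmissible_one {k : ℕ} {E : Fin k → Finset ℕ} (hne : ∀ i, (E i).Nonempty)
    (hE : Successive E) (hk : ∀ i, ∀ a ∈ E i, k ≤ a) : SAdmissible (SchreierNat 1) E := by
  refine ⟨hne, hE, mem_schreierNat_one.2 fun a ha => ?_⟩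
  obtain ⟨i, -, rfl⟩ := Finset.mem_image.1 ha
  calc _ ≤ (Finset.univ : Finset (Fin k)).card := Finset.card_image_le
    _ = k := by simp
    _ ≤ _ := hk i _ (fmin_mem (hne i))

/-- A family of finite sets indexed by a finite set `M` of integers, each located between its index
and the next one. -/
def Spaced (M : Finset ℕ) (D : ℕ → Finset ℕ) : Prop :=
  ∀ j ∈ M, ∀ a ∈ D j, j ≤ a ∧ ∀ j' ∈ M, j < j' → a < j'

lemma Spaced.mono {M : Finset ℕ} {D D' : ℕ → Finset ℕ} (h : Spaced M D)
    (hD : ∀ j ∈ M, D' j ⊆ D j) : Spaced M D' :=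
  fun j hj a ha => h j hj a (hD j hj ha)

lemma Spaced.subset {M M' : Finset ℕ} {D : ℕ → Finset ℕ} (h : Spaced M D) (hM : M' ⊆ M) :
    Spaced M' D :=
  fun j hj a ha => ⟨(h j (hM hj) a ha).1, fun j' hj' => (h j (hM hj) a ha).2 j' (hM hj')⟩

lemma Spaced.successive {k : ℕ} {M : Fin k → Finset ℕ} {D : ℕ → Finset ℕ}
    (h : Spaced (Finset.univ.biUnion M) D) (hM : Successive M) :
    Successive fun i => (M i).biUnion D := by
  intro i j hij a ha b hb
  obtain ⟨u, hu, ha⟩ := Finset.mem_biUnion.1 ha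
  obtain ⟨v, hv, hb⟩ := Finset.mem_biUnion.1 hb
  have hmem : ∀ i, M i ⊆ Finset.univ.biUnion M := fun i =>
    Finset.subset_biUnion_of_mem M (Finset.mem_univ i)
  exact ((h u (hmem i hu) a ha).2 v (hmem j hv) (hM i j hij u hu v hv)).trans_le
    (h v (hmem j hv) b hb).1

lemma SAdmissible.exists_spaced {𝒮 : Set (Finset ℕ)} {k : ℕ} {E : Fin k → Finset ℕ}
    (h : SAdmissible 𝒮 E) :
    ∃ M ∈ 𝒮, ∃ D : ℕ → Finset ℕ, Spaced M D ∧ (∀ j ∈ M, ∃ i, D j = E i) ∧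
      ∀ g : Finset ℕ → ℝ, ∑ i, g (E i) = ∑ j ∈ M, g (D j) := by
  classical
  let D : ℕ → Finset ℕ := Function.extend (fun i => fmin (E i)) E fun _ => ∅
  have hD : ∀ i, D (fmin (E i)) = E i := fun i => h.fmin_injective.extend_apply E _ i
  refine ⟨_, h.2.2, D, ?_, ?_, fun g => ?_⟩
  · intro j hj a ha
    obtain ⟨i, -, rfl⟩ := Finset.mem_image.1 hj
    rw [hD] at ha
    refine ⟨fmin_le ha, fun j' hj' hlt => ?_⟩
    obtain ⟨i', -, rfl⟩ := Finset.mem_image.1 hj'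
    have hii : i < i' := by
      by_contra hle
      obtain hle | hle := (not_lt.1 hle).lt_or_eq
      · exact lt_asymm hlt (h.fmin_lt hle)
      · subst hle
        exact lt_irrefl _ hlt
    exact h.2.1 i i' hii a ha _ (fmin_mem (h.1 i'))
  · intro j hj
    obtain ⟨i, -, rfl⟩ := Finset.mem_image.1 hj
    exact ⟨i, hD i⟩
  · rw [Finset.sum_image fun i _ j _ hij => h.fmin_injective hij]
    simp only [hD]

end Schreier

section TsirelsonNorms

lemma rpow_mul_rpow_inv_rpow {p s t : ℝ} (hp : 0 < p) (hs : 0 ≤ s) (ht : 0 ≤ t) :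
    (s ^ (1 / p) * t ^ (1 / p)) ^ p = s * t := by
  rw [← Real.mul_rpow hs ht, ← Real.rpow_mul (mul_nonneg hs ht), one_div_mul_cancel hp.ne',
    Real.rpow_one]

variable {p : ℝ} {T : (ℕ →₀ ℝ) → ℝ}

lemma IsMixedTsirelsonNorm.fsupNorm_le {N : Set ℕ} {θ : ℕ → ℝ}
    (hT : IsMixedTsirelsonNorm p N θ T) (x : ℕ →₀ ℝ) : fsupNorm x ≤ T x := by
  rw [hT x]
  exact le_max_left _ _

lemma IsMixedTsirelsonNorm.nonneg {N : Set ℕ} {θ : ℕ → ℝ}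
    (hT : IsMixedTsirelsonNorm p N θ T) (x : ℕ →₀ ℝ) : 0 ≤ T x :=
  (fsupNorm_nonneg x).trans (hT.fsupNorm_le x)

lemma IsMixedTsirelsonNorm.zero {N : Set ℕ} {θ : ℕ → ℝ} (hT : IsMixedTsirelsonNorm p N θ T)
    (hp : 0 < p) (hN : 1 ∈ N) (hθ : 0 < θ 1) : T 0 = 0 := by
  by_contra h0
  have hpos : 0 < T 0 := lt_of_le_of_ne (hT.nonneg 0) (Ne.symm h0)
  apply h0
  rw [hT 0, fsupNorm_zero, Real.sSup_of_not_bddAbove, max_self]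
  rintro ⟨b, hb⟩
  have hc : 0 < θ 1 ^ (1 / p) := Real.rpow_pos_of_pos hθ _
  have ht : 0 < T 0 ^ p := Real.rpow_pos_of_pos hpos _
  obtain ⟨k, hk⟩ := exists_nat_gt ((max b 0 / θ 1 ^ (1 / p)) ^ p / T 0 ^ p)
  rw [div_lt_iff₀ ht] at hk
  have hnn : 0 ≤ max b 0 / θ 1 ^ (1 / p) := div_nonneg (le_max_right _ _) hc.le
  have hlt := Real.rpow_lt_rpow (Real.rpow_nonneg hnn _) hk (one_div_pos.2 hp)
  rw [← Real.rpow_mul hnn, mul_one_div_cancel hp.ne', Real.rpow_one, div_lt_iff₀ hc] at hlt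
  have hmem := hb ⟨1, hN, k, fun i => {k + (i : ℕ)}, sAdmissible_one (fun i => by simp)
    (fun i j hij a ha b hb => by
      rw [Finset.mem_singleton.1 ha, Finset.mem_singleton.1 hb]
      exact Nat.add_lt_add_left hij k) (fun i a ha => by
      rw [Finset.mem_singleton.1 ha]
      exact Nat.le_add_right _ _), rfl⟩
  simp only [restr_zero, Finset.sum_const, Finset.card_univ, Fintype.card_fin, nsmul_eq_mul]
    at hmem
  linarith [le_max_left b 0, mul_comm (θ 1 ^ (1 / p)) ((k * T 0 ^ p) ^ (1 / p))]

variable {θ : ℝ}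

lemma IsT1Norm.zero (hT : IsT1Norm p θ T) (hp : 0 < p) (hθ : 0 < θ) : T 0 = 0 :=
  IsMixedTsirelsonNorm.zero hT hp rfl hθ

lemma IsT1Norm.sum_le_of_sAdmissible (hT : IsT1Norm p θ T) (hp : 0 < p) (hθ : 0 < θ)
    (x : ℕ →₀ ℝ) {k : ℕ} {E : Fin k → Finset ℕ} (hE : SAdmissible (SchreierNat 1) E) :
    θ * ∑ i, T (restr (E i) x) ^ p ≤ T x ^ p := by
  have hnn : ∀ G, 0 ≤ T (restr G x) ^ p := fun G =>
    Real.rpow_nonneg (IsMixedTsirelsonNorm.nonneg hT _) _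
  have h0 : T 0 ^ p = 0 := by rw [hT.zero hp hθ, Real.zero_rpow hp.ne']
  have hbdd : BddAbove {r : ℝ | ∃ n ∈ ({1} : Set ℕ), ∃ (k : ℕ) (E : Fin k → Finset ℕ),
      SAdmissible (SchreierNat n) E ∧
        r = θ ^ (1 / p) * (∑ i, T (restr (E i) x) ^ p) ^ (1 / p)} := by
    refine ⟨θ ^ (1 / p) * (∑ G ∈ x.support.powerset, T (restr G x) ^ p) ^ (1 / p), ?_⟩
    rintro _ ⟨n, -, k, E, hE, rfl⟩
    gcongr
    · exact Finset.sum_nonneg fun i _ => hnn _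
    · simp only [← restr_inter_support (E _) x]
      rw [← Finset.sum_filter_of_ne (p := fun i => (E i ∩ x.support).Nonempty)]
      · rw [← Finset.sum_image (f := fun G => T (restr G x) ^ p)
          (g := fun i => E i ∩ x.support)]
        · refine Finset.sum_le_sum_of_subset_of_nonneg ?_ fun G _ _ => hnn G
          intro G hG
          obtain ⟨i, -, rfl⟩ := Finset.mem_image.1 hG
          exact Finset.mem_powerset.2 Finset.inter_subset_right
        · intro i hi j hj hij
          by_contra hne
          have hd := (Successive.inter hE.2.1 x.support).disjoint hne
          simp only at hij
          rw [hij, Finset.disjoint_self_iff_empty] at hd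
          have := (Finset.mem_filter.1 (Finset.mem_coe.1 hj)).2
          simp [hd] at this
      · intro i _ hi
        by_contra hne
        rw [Finset.not_nonempty_iff_eq_empty.1 hne, restr_empty] at hi
        exact hi h0
  have hle : θ ^ (1 / p) * (∑ i, T (restr (E i) x) ^ p) ^ (1 / p) ≤ T x := by
    conv_rhs => rw [hT x]
    exact (le_csSup hbdd ⟨1, rfl, k, E, hE, rfl⟩).trans (le_max_right _ _)
  have hS : 0 ≤ ∑ i, T (restr (E i) x) ^ p := Finset.sum_nonneg fun i _ => hnn _
  rw [← rpow_mul_rpow_inv_rpow hp hθ.le hS]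
  exact Real.rpow_le_rpow (by positivity) hle hp.le

lemma IsT1Norm.sum_le_of_successive (hT : IsT1Norm p θ T) (hp : 0 < p) (hθ : 0 < θ)
    (x : ℕ →₀ ℝ) {k : ℕ} {E : Fin k → Finset ℕ} (hE : Successive E)
    (hk : ∀ i, ∀ a ∈ E i, k ≤ a) : θ * ∑ i, T (restr (E i) x) ^ p ≤ T x ^ p := by
  classical
  set I : Finset (Fin k) := Finset.univ.filter fun i => (E i).Nonempty with hI
  set e := I.orderEmbOfFin rfl with he
  have hadm : SAdmissible (SchreierNat 1) fun j => E (e j) := by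
    refine sAdmissible_one (fun j => ?_) (fun i j hij => hE _ _ (e.strictMono hij))
      fun j a ha => ?_
    · exact (Finset.mem_filter.1 (Finset.orderEmbOfFin_mem I rfl j)).2
    · have : I.card ≤ k := by simpa using Finset.card_le_univ I
      exact this.trans (hk _ a ha)
  convert hT.sum_le_of_sAdmissible hp hθ x hadm using 2
  rw [← Finset.sum_filter_of_ne (p := fun i => (E i).Nonempty), ← hI]
  · exact (congrArg (fun J => ∑ i ∈ J, T (restr (E i) x) ^ p)
      (Finset.map_orderEmbOfFin_univ I rfl)).symm.trans (Finset.sum_map _ _ _)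
  · intro i _ hi
    by_contra hne
    rw [Finset.not_nonempty_iff_eq_empty.1 hne, restr_empty, hT.zero hp hθ,
      Real.zero_rpow hp.ne'] at hi
    exact hi rfl

lemma IsT1Norm.restr_le (hT : IsT1Norm p θ T) (hp : 0 < p) (hθ : 0 < θ) (F : Finset ℕ)
    (x : ℕ →₀ ℝ) : T (restr F x) ≤ T x := by
  have hx : 0 ≤ T x := IsMixedTsirelsonNorm.nonneg hT x
  rw [hT (restr F x)]
  refine max_le ((_root_.fsupNorm_le fun i => ?_).trans
    (IsMixedTsirelsonNorm.fsupNorm_le hT x)) (Real.sSup_le ?_ hx)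
  · rw [restr_apply]
    split_ifs
    · exact abs_le_fsupNorm x i
    · simpa using fsupNorm_nonneg x
  · rintro _ ⟨n, hn, k, E, hE, rfl⟩
    obtain rfl : n = 1 := hn
    have hS : 0 ≤ ∑ i, T (restr (E i) (restr F x)) ^ p := Finset.sum_nonneg fun i _ =>
      Real.rpow_nonneg (IsMixedTsirelsonNorm.nonneg hT _) _
    rw [← Real.rpow_le_rpow_iff (by positivity) hx hp, rpow_mul_rpow_inv_rpow hp hθ.le hS]
    simp only [restr_restr]
    exact hT.sum_le_of_successive hp hθ x (Successive.inter hE.2.1 F) fun i a ha =>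
      hE.le_of_mem i (Finset.mem_inter.1 ha).1

lemma Finset.sum_biUnion_of_successive {k : ℕ} {M : Fin k → Finset ℕ} (hM : Successive M)
    (g : ℕ → ℝ) : ∑ j ∈ Finset.univ.biUnion M, g j = ∑ i, ∑ j ∈ M i, g j :=
  Finset.sum_biUnion fun _ _ _ _ hij => hM.disjoint hij

lemma IsT1Norm.sum_le_of_spaced (hT : IsT1Norm p θ T) (hp : 0 < p) (hθ : 0 < θ) {n : ℕ}
    {M : Finset ℕ} (hM : M ∈ SchreierNat n) {D : ℕ → Finset ℕ} (hD : Spaced M D)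
    (x : ℕ →₀ ℝ) : θ ^ n * ∑ j ∈ M, T (restr (D j) x) ^ p ≤ T x ^ p := by
  induction n generalizing M x with
  | zero =>
    obtain h | h := Nat.le_one_iff_eq_zero_or_eq_one.1 (show M.card ≤ 1 from hM)
    · rw [Finset.card_eq_zero.1 h]
      simpa using Real.rpow_nonneg (IsMixedTsirelsonNorm.nonneg hT x) p
    · obtain ⟨j, rfl⟩ := Finset.card_eq_one.1 h
      simpa using Real.rpow_le_rpow (IsMixedTsirelsonNorm.nonneg hT _)
        (hT.restr_le hp hθ (D j) x) hp.le
  | succ n ih =>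
    obtain ⟨k, L, hL, hsucc, hk, rfl⟩ := hM
    have hsub : ∀ i, L i ⊆ Finset.univ.biUnion L := fun i =>
      Finset.subset_biUnion_of_mem L (Finset.mem_univ i)
    rw [Finset.sum_biUnion_of_successive hsucc, pow_succ', mul_assoc, Finset.mul_sum]
    refine le_trans ?_ (hT.sum_le_of_successive hp hθ x (hD.successive hsucc) fun i a ha => ?_)
    · gcongr with i
      have := ih (hL i) (hD.subset (hsub i)) (restr ((L i).biUnion D) x)
      rwa [Finset.sum_congr rfl fun j hj => by
        rw [restr_restr_of_subset (Finset.subset_biUnion_of_mem D hj)]] at this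
    · obtain ⟨j, hj, ha⟩ := Finset.mem_biUnion.1 ha
      exact (hk i j hj).trans (hD j (hsub i hj) a ha).1

end TsirelsonNorms

section Families

/-- All unions `F ∪ G` with `F < G`, `F ∈ 𝒜` and `G ∈ ℬ`. -/
def concat (𝒜 ℬ : Set (Finset ℕ)) : Set (Finset ℕ) :=
  {H | ∃ F ∈ 𝒜, ∃ G ∈ ℬ, (∀ a ∈ F, ∀ b ∈ G, a < b) ∧ H = F ∪ G}

/-- Unions of `k` successive members of `𝒜`. -/
def concatPow (𝒜 : Set (Finset ℕ)) : ℕ → Set (Finset ℕ)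
  | 0 => {∅}
  | k + 1 => concat 𝒜 (concatPow 𝒜 k)

/-- A variant of the Schreier families in which `0` plays the same role as the other integers. -/
def shiftedSchreier : ℕ → Set (Finset ℕ)
  | 0 => {F | F.card ≤ 1}
  | m + 1 => {F | ∃ k, F ∈ concatPow (shiftedSchreier m) k ∧ ∀ a ∈ F, k ≤ a + 1}

/-- Closure under subsets. -/
def IsHereditary (𝒜 : Set (Finset ℕ)) : Prop := ∀ F ∈ 𝒜, ∀ G ⊆ F, G ∈ 𝒜

/-- Closure under moving elements to the right. -/
def IsSpreading (𝒜 : Set (Finset ℕ)) : Prop :=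
  ∀ F ∈ 𝒜, ∀ f : ℕ → ℕ, (∀ i ∈ F, ∀ j ∈ F, i < j → f i < f j) →
    (∀ i ∈ F, i ≤ f i) → F.image f ∈ 𝒜

variable {𝒜 ℬ : Set (Finset ℕ)}

lemma IsHereditary.concat (hA : IsHereditary 𝒜) (hB : IsHereditary ℬ) :
    IsHereditary (concat 𝒜 ℬ) := by
  rintro _ ⟨F, hF, G, hG, hlt, rfl⟩ H hH
  refine ⟨F ∩ H, hA F hF _ Finset.inter_subset_left, G ∩ H, hB G hG _ Finset.inter_subset_left,
    fun a ha b hb => hlt a (Finset.mem_inter.1 ha).1 b (Finset.mem_inter.1 hb).1, ?_⟩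
  rw [← Finset.union_inter_distrib_right, Finset.inter_eq_right.2 hH]

lemma IsHereditary.concatPow (hA : IsHereditary 𝒜) : ∀ k, IsHereditary (concatPow 𝒜 k)
  | 0 => by
    rintro _ rfl G hG
    exact Finset.subset_empty.1 hG
  | k + 1 => hA.concat (hA.concatPow k)

lemma IsSpreading.concat (hA : IsSpreading 𝒜) (hB : IsSpreading ℬ) :
    IsSpreading (concat 𝒜 ℬ) := by
  rintro _ ⟨F, hF, G, hG, hlt, rfl⟩ f hf hle
  refine ⟨F.image f, hA F hF f (fun i hi j hj => hf i (Finset.mem_union_left _ hi) j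
      (Finset.mem_union_left _ hj)) fun i hi => hle i (Finset.mem_union_left _ hi),
    G.image f, hB G hG f (fun i hi j hj => hf i (Finset.mem_union_right _ hi) j
      (Finset.mem_union_right _ hj)) fun i hi => hle i (Finset.mem_union_right _ hi),
    fun a ha b hb => ?_, Finset.image_union _ _⟩
  obtain ⟨i, hi, rfl⟩ := Finset.mem_image.1 ha
  obtain ⟨j, hj, rfl⟩ := Finset.mem_image.1 hb
  exact hf i (Finset.mem_union_left _ hi) j (Finset.mem_union_right _ hj) (hlt i hi j hj)

lemma IsSpreading.concatPow (hA : IsSpreading 𝒜) : ∀ k, IsSpreading (concatPow 𝒜 k)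
  | 0 => by
    rintro _ rfl f - -
    rfl
  | k + 1 => hA.concat (hA.concatPow k)

lemma concatPow_mono (h0 : ∅ ∈ 𝒜) : Monotone (concatPow 𝒜) :=
  monotone_nat_of_le_succ fun k F hF => ⟨∅, h0, F, hF, by simp, by simp⟩

lemma biUnion_mem_concatPow {k : ℕ} {E : Fin k → Finset ℕ} (hE : Successive E)
    (hmem : ∀ i, E i ∈ 𝒜) : Finset.univ.biUnion E ∈ concatPow 𝒜 k := by
  induction k with
  | zero => rfl
  | succ k ih =>
    refine ⟨E 0, hmem 0, Finset.univ.biUnion fun i : Fin k => E i.succ,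
      ih (fun i j hij => hE _ _ (Fin.succ_lt_succ_iff.2 hij)) fun i => hmem _, ?_, ?_⟩
    · intro a ha b hb
      obtain ⟨i, -, hi⟩ := Finset.mem_biUnion.1 hb
      exact hE 0 i.succ i.succ_pos a ha b hi
    · ext a
      simp [Fin.exists_fin_succ]

lemma isHereditary_shiftedSchreier : ∀ m, IsHereditary (shiftedSchreier m)
  | 0 => fun _ hF _ hG => (Finset.card_le_card hG).trans hF
  | m + 1 => by
    rintro F ⟨k, hF, hk⟩ G hG
    exact ⟨k, (isHereditary_shiftedSchreier m).concatPow k F hF G hG, fun a ha => hk a (hG ha)⟩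

lemma isSpreading_shiftedSchreier : ∀ m, IsSpreading (shiftedSchreier m)
  | 0 => fun _ hF _ _ _ => Finset.card_image_le.trans hF
  | m + 1 => by
    rintro F ⟨k, hF, hk⟩ f hf hle
    refine ⟨k, (isSpreading_shiftedSchreier m).concatPow k F hF f hf hle, fun a ha => ?_⟩
    obtain ⟨i, hi, rfl⟩ := Finset.mem_image.1 ha
    exact (hk i hi).trans (Nat.succ_le_succ (hle i hi))

lemma shiftedSchreier_subset_succ (m : ℕ) : shiftedSchreier m ⊆ shiftedSchreier (m + 1) :=
  fun F hF => ⟨1, ⟨F, hF, ∅, rfl, by simp, by simp⟩, fun a _ => Nat.le_add_left 1 a⟩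

lemma shiftedSchreier_mono : Monotone shiftedSchreier :=
  monotone_nat_of_le_succ shiftedSchreier_subset_succ

lemma singleton_mem_shiftedSchreier (m i : ℕ) : {i} ∈ shiftedSchreier m :=
  shiftedSchreier_mono (Nat.zero_le m) (show ({i} : Finset ℕ).card ≤ 1 by simp)

lemma empty_mem_shiftedSchreier (m : ℕ) : ∅ ∈ shiftedSchreier m :=
  isHereditary_shiftedSchreier m _ (singleton_mem_shiftedSchreier m 0) _ (Finset.empty_subset _)

lemma Spaced.biUnion_mem_shiftedSchreier {r n : ℕ} {M : Finset ℕ} (hM : M ∈ SchreierNat n)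
    {F : ℕ → Finset ℕ} (hF : Spaced M F) (hmem : ∀ j ∈ M, F j ∈ shiftedSchreier r) :
    M.biUnion F ∈ shiftedSchreier (r + n) := by
  induction n generalizing M with
  | zero =>
    obtain h | h := Nat.le_one_iff_eq_zero_or_eq_one.1 (show M.card ≤ 1 from hM)
    · rw [Finset.card_eq_zero.1 h]
      exact empty_mem_shiftedSchreier _
    · obtain ⟨j, rfl⟩ := Finset.card_eq_one.1 h
      simpa using hmem
  | succ n ih =>
    obtain ⟨k, L, hL, hsucc, hk, rfl⟩ := hM
    have hsub : ∀ i, L i ⊆ Finset.univ.biUnion L := fun i =>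
      Finset.subset_biUnion_of_mem L (Finset.mem_univ i)
    refine ⟨k, ?_, fun a ha => ?_⟩
    · rw [Finset.biUnion_biUnion]
      exact biUnion_mem_concatPow (hF.successive hsucc) fun i =>
        ih (hL i) (hF.subset (hsub i)) fun j hj => hmem j (hsub i hj)
    · obtain ⟨j, hj, ha⟩ := Finset.mem_biUnion.1 ha
      obtain ⟨i, -, hi⟩ := Finset.mem_biUnion.1 hj
      exact ((hk i j hi).trans (hF j hj a ha).1).trans (Nat.le_succ a)

end Families

section CantorBendixson

lemma finsetToFun_eq_true {F : Finset ℕ} {n : ℕ} : finsetToFun F n = true ↔ n ∈ F := by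
  simp [finsetToFun]

lemma finsetToFun_congr {F G : Finset ℕ} {n m : ℕ} (h : n ∈ F ↔ m ∈ G) :
    finsetToFun F n = finsetToFun G m := by
  simp [finsetToFun, h]

lemma finsetToFun_injective : Function.Injective finsetToFun := by
  intro F G h
  ext n
  rw [← finsetToFun_eq_true, h, finsetToFun_eq_true]

lemma setOf_forall_eq_mem_nhds (x : ℕ → Bool) (n : ℕ) :
    {y : ℕ → Bool | ∀ i ∈ Finset.range n, y i = x i} ∈ nhds x := by
  rw [← Filter.eventually_iff (f := nhds x)]
  exact (Filter.eventually_all_finset _).2 fun i _ =>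
    ((continuous_apply (A := fun _ : ℕ => Bool) i).tendsto x).eventually
      (p := fun b => b = x i) (by rw [nhds_discrete]; exact Filter.eventually_pure.2 rfl)

lemma cbIter_zero (S : Set (ℕ → Bool)) : cbIter S 0 = S := by
  simp [cbIter]

lemma cbIter_add_one (S : Set (ℕ → Bool)) (o : Ordinal) :
    cbIter S (o + 1) = {x | x ∈ cbIter S o ∧ AccPt x (Filter.principal (cbIter S o))} := by
  simp only [cbIter]
  rw [Ordinal.limitRecOn_add_one]

lemma cbIter_limit (S : Set (ℕ → Bool)) {o : Ordinal} (ho : Order.IsSuccLimit o) :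
    cbIter S o = ⋂ b : {b : Ordinal // b < o}, cbIter S b.1 := by
  simp only [cbIter]
  rw [Ordinal.limitRecOn_limit _ _ _ _ ho]

lemma cbIter_antitone (S : Set (ℕ → Bool)) : Antitone (cbIter S) := by
  intro a b hab
  induction b using Ordinal.limitRecOn with
  | zero => rw [nonpos_iff_eq_zero.1 hab]
  | add_one b ih =>
    obtain rfl | h := hab.eq_or_lt
    · exact le_rfl
    · rw [cbIter_add_one]
      exact fun x hx => ih (Order.lt_add_one_iff.1 h) hx.1
  | limit b hb ih =>
    obtain rfl | h := hab.eq_or_lt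
    · exact le_rfl
    · rw [cbIter_limit S hb]
      exact Set.iInter_subset_of_subset ⟨a, h⟩ le_rfl

lemma cbIter_add (S : Set (ℕ → Bool)) (a b : Ordinal) :
    cbIter S (a + b) = cbIter (cbIter S a) b := by
  induction b using Ordinal.limitRecOn with
  | zero => rw [add_zero, cbIter_zero]
  | add_one b ih => rw [← add_assoc, cbIter_add_one, cbIter_add_one, ih]
  | limit b hb ih =>
    rw [cbIter_limit _ hb, cbIter_limit S (Ordinal.isSuccLimit_add a hb)]
    apply subset_antisymm
    · refine Set.subset_iInter fun c => ?_
      rw [← ih c.1 c.2]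
      exact Set.iInter_subset_of_subset ⟨a + c.1, by simpa using c.2⟩ le_rfl
    · refine Set.subset_iInter fun c => ?_
      obtain ⟨d, hd, hcd⟩ := (Ordinal.lt_add_iff hb.ne_bot).1 c.2
      refine Set.iInter_subset_of_subset ⟨d, hd⟩ ?_
      rw [← ih d hd]
      exact cbIter_antitone S hcd

/-- `G` is obtained from `F` by adding elements beyond all those of `F`. -/
def EndExtends (F G : Finset ℕ) : Prop :=
  F ⊂ G ∧ ∀ b ∈ G, b ∉ F → ∀ a ∈ F, a < b

/-- There is a rank function on `𝒜` with values below `μ` which decreases along end extensions. -/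
def HasRankBelow (𝒜 : Set (Finset ℕ)) (μ : Ordinal.{0}) : Prop :=
  ∃ ρ : Finset ℕ → Ordinal.{0}, (∀ F ∈ 𝒜, ρ F < μ) ∧
    ∀ F ∈ 𝒜, ∀ G ∈ 𝒜, EndExtends F G → ρ G < ρ F

variable {𝒜 : Set (Finset ℕ)} {μ : Ordinal.{0}}

lemma HasRankBelow.isCompact (hρ : HasRankBelow 𝒜 μ) (hA : IsHereditary 𝒜) :
    IsCompact (finsetToFun '' 𝒜) := by
  obtain ⟨ρ, -, hρ⟩ := hρ
  refine IsClosed.isCompact (isClosed_of_closure_subset fun x hx => ?_)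
  let X : ℕ → Finset ℕ := fun n => (Finset.range n).filter fun i => x i = true
  have hX : ∀ n, X n ∈ 𝒜 := by
    intro n
    obtain ⟨_, hy, F, hF, rfl⟩ := mem_closure_iff_nhds.1 hx _ (setOf_forall_eq_mem_nhds x n)
    refine hA F hF _ fun i hi => ?_
    obtain ⟨hi, hxi⟩ := Finset.mem_filter.1 hi
    rw [← finsetToFun_eq_true, hy i hi, hxi]
  by_cases hfin : {i | x i = true}.Finite
  · obtain ⟨n, hn⟩ := hfin.bddAbove
    refine ⟨X (n + 1), hX _, funext fun i => Bool.eq_iff_iff.2 ?_⟩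
    rw [finsetToFun_eq_true, Finset.mem_filter, Finset.mem_range, Nat.lt_succ_iff]
    exact ⟨fun h => h.2, fun h => ⟨hn h, h⟩⟩
  · exfalso
    obtain ⟨_, ⟨n, rfl⟩, hn⟩ := WellFounded.has_min (wellFounded_lt (α := Ordinal.{0}))
      (Set.range fun n => ρ (X n)) ⟨_, 0, rfl⟩
    obtain ⟨i, hi, hni⟩ := Set.Infinite.exists_gt hfin n
    refine hn _ ⟨i + 1, rfl⟩ (hρ _ (hX n) _ (hX (i + 1)) ⟨Finset.ssubset_iff.2 ⟨i, ?_, ?_⟩, ?_⟩)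
    · simp [X, hni.le]
    · refine Finset.insert_subset (by simpa [X] using hi) fun j hj => ?_
      simp only [X, Finset.mem_filter, Finset.mem_range] at hj ⊢
      exact ⟨by omega, hj.2⟩
    · intro b hb hbn a ha
      simp only [X, Finset.mem_filter, Finset.mem_range] at hb hbn ha
      by_contra hle
      exact hbn ⟨by omega, hb.2⟩

lemma HasRankBelow.cbIter_eq_empty (hρ : HasRankBelow 𝒜 μ) : cbIter (finsetToFun '' 𝒜) μ = ∅ := by
  obtain ⟨ρ, hμ, hρ⟩ := hρ
  have key : ∀ o, cbIter (finsetToFun '' 𝒜) o ⊆ finsetToFun '' {F ∈ 𝒜 | o ≤ ρ F} := by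
    intro o
    induction o using Ordinal.limitRecOn with
    | zero => simp [cbIter_zero]
    | add_one o ih =>
      rw [cbIter_add_one]
      rintro _ ⟨hx, hacc⟩
      obtain ⟨F, ⟨hF, hoF⟩, rfl⟩ := ih hx
      refine ⟨F, ⟨hF, Order.add_one_le_of_lt ?_⟩, rfl⟩
      obtain ⟨y, ⟨hyU, hy⟩, hne⟩ := accPt_iff_nhds.1 hacc _
        (setOf_forall_eq_mem_nhds (finsetToFun F) (F.sup id + 1))
      obtain ⟨G, ⟨hG, hoG⟩, rfl⟩ := ih hy
      have hle : ∀ i ∈ F, i < F.sup id + 1 := fun i hi =>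
        Nat.lt_succ_iff.2 (Finset.le_sup (f := id) hi)
      have hiff : ∀ i < F.sup id + 1, (i ∈ G ↔ i ∈ F) := fun i hi => by
        rw [← finsetToFun_eq_true, hyU i (Finset.mem_range.2 hi), finsetToFun_eq_true]
      refine hoG.trans_lt (hρ F hF G hG ⟨Finset.ssubset_iff_subset_ne.2
        ⟨fun i hi => (hiff i (hle i hi)).2 hi, fun h => hne (h ▸ rfl)⟩, fun b hb hbF a ha => ?_⟩)
      by_contra hba
      exact hbF ((hiff b ((not_lt.1 hba).trans_lt (hle a ha))).1 hb)
    | limit o ho ih =>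
      intro x hx
      rw [cbIter_limit _ ho, Set.mem_iInter] at hx
      obtain ⟨F, ⟨hF, -⟩, rfl⟩ := ih 0 ho.bot_lt (hx ⟨0, ho.bot_lt⟩)
      refine ⟨F, ⟨hF, le_of_forall_lt fun b hb => ?_⟩, rfl⟩
      obtain ⟨F', ⟨-, hF'⟩, he⟩ := ih _ (ho.succ_lt hb) (hx ⟨_, ho.succ_lt hb⟩)
      rw [finsetToFun_injective he] at hF'
      exact Order.succ_le_iff.1 hF'
  refine Set.eq_empty_of_subset_empty ((key μ).trans ?_)
  rintro _ ⟨F, ⟨hF, hle⟩, rfl⟩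
  exact (hμ F hF).not_ge hle

lemma HasRankBelow.cbIndex_le (hρ : HasRankBelow 𝒜 μ) : CBIndex 𝒜 ≤ μ :=
  csInf_le' hρ.cbIter_eq_empty

end CantorBendixson

section Rank

variable {𝒜 ℬ : Set (Finset ℕ)} {μ ν : Ordinal.{0}}

/-- The rank of a splitting `F ∪ G` in a concatenation, given the rank functions of the factors and
a bound `ν` of the second one. -/
noncomputable def splitRank (ρ σ : Finset ℕ → Ordinal.{0}) (ν : Ordinal.{0})
    (s : Finset ℕ × Finset ℕ) : Ordinal.{0} :=
  if s.2 = ∅ then ν + ρ s.1 else σ s.2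

open Classical in
/-- The ordered splittings of `H` into a member of `𝒜` and a member of `ℬ`. -/
noncomputable def splittings (𝒜 ℬ : Set (Finset ℕ)) (H : Finset ℕ) :
    Finset (Finset ℕ × Finset ℕ) :=
  (H.powerset ×ˢ H.powerset).filter fun s =>
    s.1 ∈ 𝒜 ∧ s.2 ∈ ℬ ∧ (∀ a ∈ s.1, ∀ b ∈ s.2, a < b) ∧ H = s.1 ∪ s.2

lemma mem_splittings {H : Finset ℕ} {s : Finset ℕ × Finset ℕ} :
    s ∈ splittings 𝒜 ℬ H ↔
      s.1 ∈ 𝒜 ∧ s.2 ∈ ℬ ∧ (∀ a ∈ s.1, ∀ b ∈ s.2, a < b) ∧ H = s.1 ∪ s.2 := by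
  simp only [splittings, Finset.mem_filter, Finset.mem_product, Finset.mem_powerset,
    and_iff_right_iff_imp]
  rintro ⟨-, -, -, rfl⟩
  exact ⟨Finset.subset_union_left, Finset.subset_union_right⟩

lemma splittings_nonempty {H : Finset ℕ} (h : H ∈ concat 𝒜 ℬ) : (splittings 𝒜 ℬ H).Nonempty := by
  obtain ⟨F, hF, G, hG, hlt, rfl⟩ := h
  exact ⟨(F, G), mem_splittings.2 ⟨hF, hG, hlt, rfl⟩⟩

lemma EndExtends.inter {F F₁ F₂ : Finset ℕ} (h : EndExtends F (F₁ ∪ F₂))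
    (hlt : ∀ a ∈ F₁, ∀ b ∈ F₂, a < b) (hne : (F₂ ∩ F).Nonempty) : EndExtends (F₂ ∩ F) F₂ := by
  obtain ⟨c, hc⟩ := hne
  obtain ⟨hc₂, hcF⟩ := Finset.mem_inter.1 hc
  refine ⟨Finset.ssubset_iff_subset_ne.2 ⟨Finset.inter_subset_left, fun he => ?_⟩,
    fun b hb hbF a ha => ?_⟩
  · obtain ⟨b, hb, hbF⟩ := Finset.exists_of_ssubset h.1
    obtain hb₁ | hb₂ := Finset.mem_union.1 hb
    · exact lt_asymm (hlt b hb₁ c hc₂) (h.2 b hb hbF c hcF)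
    · rw [← he] at hb₂
      exact hbF (Finset.mem_inter.1 hb₂).2
  · exact h.2 b (Finset.mem_union_right _ hb) (fun hb' => hbF (Finset.mem_inter.2 ⟨hb, hb'⟩)) a
      (Finset.mem_inter.1 ha).2

lemma HasRankBelow.concat (hA : HasRankBelow 𝒜 μ) (hB : HasRankBelow ℬ ν)
    (hereA : IsHereditary 𝒜) (hereB : IsHereditary ℬ) :
    HasRankBelow (concat 𝒜 ℬ) (ν + μ) := by
  obtain ⟨ρ, hρμ, hρ⟩ := hA
  obtain ⟨σ, hσν, hσ⟩ := hB
  refine ⟨fun H => (splittings 𝒜 ℬ H).sup (splitRank ρ σ ν), fun H hH => ?_,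
    fun F hF H hH hFH => ?_⟩
  all_goals
    obtain ⟨⟨H₁, H₂⟩, hs, he⟩ := Finset.exists_mem_eq_sup _ (splittings_nonempty hH)
      (splitRank ρ σ ν)
    obtain ⟨h₁, h₂, hlt, hunion⟩ := mem_splittings.1 hs
    simp only at h₁ h₂ hlt hunion
    simp only [he]
  · unfold splitRank
    split_ifs
    · exact add_lt_add_right (hρμ _ h₁) ν
    · exact (hσν _ h₂).trans_le le_self_add
  · subst hunion
    have hmem : (H₁ ∩ F, H₂ ∩ F) ∈ splittings 𝒜 ℬ F := mem_splittings.2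
      ⟨hereA _ h₁ _ Finset.inter_subset_left, hereB _ h₂ _ Finset.inter_subset_left,
        fun a ha b hb => hlt a (Finset.mem_inter.1 ha).1 b (Finset.mem_inter.1 hb).1, by
        rw [← Finset.union_inter_distrib_right, Finset.inter_eq_right.2 hFH.1.1]⟩
    refine lt_of_lt_of_le ?_ (Finset.le_sup hmem)
    by_cases hF₂ : H₂ ∩ F = ∅
    · rw [splitRank, splitRank, if_pos hF₂]
      split_ifs with hH₂
      · simp only at hH₂
        subst hH₂
        rw [Finset.union_empty] at hFH
        rw [Finset.inter_eq_right.2 hFH.1.1]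
        exact add_lt_add_right (hρ F (hereA _ h₁ _ hFH.1.1) H₁ h₁ hFH) ν
      · exact (hσν _ h₂).trans_le le_self_add
    · have hne := Finset.nonempty_iff_ne_empty.2 hF₂
      have hH₂ : H₂ ≠ ∅ := fun h => hF₂ (by rw [h, Finset.empty_inter])
      rw [splitRank, splitRank, if_neg hF₂, if_neg hH₂]
      exact hσ _ (hereB _ h₂ _ Finset.inter_subset_left) _ h₂ (hFH.inter hlt hne)

open Ordinal in
lemma omega0_pow_lt_omega0_pow_succ (m : ℕ) : (ω : Ordinal.{0}) ^ m < ω ^ (m + 1) := by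
  rw [← Ordinal.opow_natCast, ← Ordinal.opow_natCast]
  exact (Ordinal.opow_lt_opow_iff_right Ordinal.one_lt_omega0).2
    (Nat.cast_lt.2 m.lt_succ_self)

open Ordinal in
lemma HasRankBelow.concatPow {m : ℕ} (hA : HasRankBelow 𝒜 (ω ^ m + 1)) (hereA : IsHereditary 𝒜)
    (k : ℕ) : ∃ μ < ω ^ (m + 1), HasRankBelow (concatPow 𝒜 k) μ := by
  have hone : (1 : Ordinal) < ω ^ (m + 1) :=
    (one_le_pow₀ Ordinal.one_lt_omega0.le).trans_lt (omega0_pow_lt_omega0_pow_succ m)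
  have hprin : Ordinal.IsPrincipal (· + ·) ((ω : Ordinal.{0}) ^ (m + 1)) :=
    Ordinal.opow_natCast ω (m + 1) ▸ Ordinal.isPrincipal_add_omega0_opow _
  induction k with
  | zero =>
    refine ⟨1, hone, fun _ => 0, fun _ _ => zero_lt_one, ?_⟩
    rintro _ rfl _ rfl h
    exact absurd h.1 (ssubset_irrefl _)
  | succ k ih =>
    obtain ⟨ν, hν, hk⟩ := ih
    refine ⟨_, hprin hν (hprin (omega0_pow_lt_omega0_pow_succ m) hone),
      hA.concat hk hereA (hereA.concatPow k)⟩

open Ordinal in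
lemma hasRankBelow_shiftedSchreier (m : ℕ) : HasRankBelow (shiftedSchreier m) (ω ^ m + 1) := by
  induction m with
  | zero =>
    refine ⟨fun F => if F = ∅ then 1 else 0, fun F _ => ?_, fun F hF G hG h => ?_⟩
    · dsimp only
      split_ifs <;> simp
    · have hlt := Finset.card_lt_card h.1
      have hG : G.card ≤ 1 := hG
      have hF : F = ∅ := Finset.card_eq_zero.1 (by omega)
      have hG : G ≠ ∅ := by
        rintro rfl
        simp at hlt
      simp [hF, hG]
  | succ m ih =>
    choose μ hμ hrank using fun k =>
      ih.concatPow (isHereditary_shiftedSchreier m) k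
    choose ρ hρμ hρ using hrank
    have hmem : ∀ F ∈ shiftedSchreier (m + 1), F ≠ ∅ →
        F ∈ concatPow (shiftedSchreier m) (fmin F + 1) := by
      rintro F ⟨k, hF, hk⟩ hne
      exact concatPow_mono (empty_mem_shiftedSchreier m)
        (hk _ (fmin_mem (Finset.nonempty_iff_ne_empty.2 hne))) hF
    have hlt : ∀ F ∈ shiftedSchreier (m + 1), F ≠ ∅ → ρ (fmin F + 1) F < ω ^ (m + 1) :=
      fun F hF hne => (hρμ _ F (hmem F hF hne)).trans (hμ _)
    refine ⟨fun F => if F = ∅ then ω ^ (m + 1) else ρ (fmin F + 1) F, fun F hF => ?_,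
      fun F hF G hG h => ?_⟩
    · dsimp only
      split_ifs with h
      · exact Order.lt_add_one_iff.2 le_rfl
      · exact (hlt F hF h).trans_le le_self_add
    · have hGne : G ≠ ∅ := (h.1.bot_lt).ne'
      dsimp only
      rw [if_neg hGne]
      split_ifs with hFe
      · exact hlt G hG hGne
      · have hFne := Finset.nonempty_iff_ne_empty.2 hFe
        have hGne' := Finset.nonempty_iff_ne_empty.2 hGne
        have hmin : fmin G = fmin F := by
          refine le_antisymm (fmin_le (h.1.1 (fmin_mem hFne))) ?_
          by_cases hGF : fmin G ∈ F
          · exact fmin_le hGF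
          · exact (h.2 _ (fmin_mem hGne') hGF _ (fmin_mem hFne)).le
        have hG' := hmem G hG hGne
        rw [hmin] at hG' ⊢
        exact hρ _ F (hmem F hF hFe) G hG' h

open Ordinal in
lemma finsetToFun_mem_cbIter (m : ℕ) (𝒞 : Set (ℕ → Bool)) (H : Finset ℕ) (l : ℕ)
    (h : ∀ G ∈ shiftedSchreier m, (∀ a ∈ G, l ≤ a) → finsetToFun (H ∪ G) ∈ 𝒞) :
    finsetToFun H ∈ cbIter 𝒞 (ω ^ m) := by
  induction m generalizing 𝒞 H l with
  | zero =>
    rw [pow_zero, ← zero_add 1, cbIter_add_one, cbIter_zero]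
    refine ⟨by simpa using h ∅ (empty_mem_shiftedSchreier 0) (by simp),
      accPt_iff_nhds.2 fun U hU => ?_⟩
    have hlim : Tendsto (fun j => finsetToFun (H ∪ {j})) atTop (nhds (finsetToFun H)) := by
      refine tendsto_pi_nhds.2 fun i => tendsto_const_nhds.congr' ?_
      filter_upwards [eventually_gt_atTop i] with j hj
      exact finsetToFun_congr (by simp [hj.ne])
    obtain ⟨j, hjU, hjl, hjH⟩ := ((hlim.eventually hU).and
      ((eventually_ge_atTop l).and (eventually_gt_atTop (H.sup id)))).exists
    refine ⟨finsetToFun (H ∪ {j}), ⟨hjU, h _ (singleton_mem_shiftedSchreier 0 j) (by simpa)⟩,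
      fun he => ?_⟩
    have hj : j ∈ H := by
      rw [← finsetToFun_injective he]
      simp
    exact absurd (Finset.le_sup (f := id) hj) (not_le.2 hjH)
  | succ m ih =>
    have hpow : ∀ k : ℕ, ∀ (𝒞 : Set (ℕ → Bool)) (H : Finset ℕ) (l : ℕ),
        (∀ G ∈ concatPow (shiftedSchreier m) k, (∀ a ∈ G, l ≤ a) → finsetToFun (H ∪ G) ∈ 𝒞) →
        finsetToFun H ∈ cbIter 𝒞 (ω ^ m * k) := by
      intro k
      induction k with
      | zero =>
        intro 𝒞 H l h
        simpa [cbIter_zero] using h ∅ rfl (by simp)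
      | succ k ihk =>
        intro 𝒞 H l h
        rw [Nat.cast_add_one, mul_add_one, cbIter_add]
        refine ih _ H l fun G hG hl => ihk 𝒞 (H ∪ G) (max l (G.sup id + 1)) fun K hK hlK => ?_
        rw [Finset.union_assoc]
        refine h _ ⟨G, hG, K, hK, fun a ha b hb => ?_, rfl⟩ fun a ha => ?_
        · exact (Nat.lt_succ_iff.2 (Finset.le_sup (f := id) ha)).trans_le
            ((le_max_right _ _).trans (hlK b hb))
        · obtain ha | ha := Finset.mem_union.1 ha
          · exact hl a ha
          · exact (le_max_left _ _).trans (hlK a ha)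
    have hlim : Order.IsSuccLimit ((ω : Ordinal) ^ (m + 1)) := by
      rw [← Ordinal.opow_natCast]
      exact Ordinal.isSuccLimit_opow_left Ordinal.isSuccLimit_omega0
        (Nat.cast_ne_zero.2 m.succ_ne_zero)
    rw [cbIter_limit _ hlim, Set.mem_iInter]
    rintro ⟨b, hb⟩
    rw [pow_succ, Ordinal.lt_mul_iff_of_isSuccLimit Ordinal.isSuccLimit_omega0] at hb
    obtain ⟨c, hc, hbc⟩ := hb
    obtain ⟨k, rfl⟩ := Ordinal.lt_omega0.1 hc
    refine cbIter_antitone 𝒞 hbc.le (hpow k 𝒞 H (max l k) fun G hG hl => ?_)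
    exact h G ⟨k, hG, fun a ha => ((le_max_right _ _).trans (hl a ha)).trans (Nat.le_succ a)⟩
      fun a ha => (le_max_left _ _).trans (hl a ha)

open Ordinal in
lemma lt_cbIndex_shiftedSchreier (m : ℕ) : (ω : Ordinal.{0}) ^ m < CBIndex (shiftedSchreier m) := by
  by_contra hle
  have hmem : cbIter (finsetToFun '' shiftedSchreier m) (CBIndex.{0} (shiftedSchreier m)) = ∅ :=
    csInf_mem (s := {o | cbIter (finsetToFun '' shiftedSchreier m) o = ∅})
      ⟨_, (hasRankBelow_shiftedSchreier m).cbIter_eq_empty⟩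
  have h := cbIter_antitone _ (not_lt.1 hle) (finsetToFun_mem_cbIter m
    (finsetToFun '' shiftedSchreier m) ∅ 0 fun G hG _ => ⟨G, hG, by rw [Finset.empty_union]⟩)
  rw [hmem] at h
  exact h

open Ordinal in
lemma goodScale_shiftedSchreier : GoodScale (ω : Ordinal.{0}) shiftedSchreier := by
  have hpow : ∀ m : ℕ, (ω : Ordinal.{0}) ^ m < ω ^ (ω : Ordinal.{0}) := fun m => by
    rw [← Ordinal.opow_natCast]
    exact (Ordinal.opow_lt_opow_iff_right Ordinal.one_lt_omega0).2 (Ordinal.natCast_lt_omega0 m)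
  refine ⟨fun n => ⟨Set.to_countable _, isHereditary_shiftedSchreier n,
    isSpreading_shiftedSchreier n, (hasRankBelow_shiftedSchreier n).isCompact
      (isHereditary_shiftedSchreier n)⟩, shiftedSchreier_subset_succ, fun n => ?_, fun β hβ => ?_⟩
  · exact (hasRankBelow_shiftedSchreier n).cbIndex_le.trans_lt ((Order.add_one_le_of_lt
      (omega0_pow_lt_omega0_pow_succ n)).trans_lt (hpow (n + 1)))
  · obtain ⟨c, hc, hβ⟩ := (Ordinal.lt_opow_of_isSuccLimit Ordinal.omega0_ne_zero
      Ordinal.isSuccLimit_omega0).1 hβ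
    obtain ⟨m, rfl⟩ := Ordinal.lt_omega0.1 hc
    rw [Ordinal.opow_natCast] at hβ
    exact ⟨m, hβ.trans (lt_cbIndex_shiftedSchreier m)⟩

end Rank

section ContainsC0

lemma fsupNorm_smul (c : ℝ) (x : ℕ →₀ ℝ) : fsupNorm (c • x) = |c| * fsupNorm x := by
  simp only [fsupNorm, Finsupp.smul_apply, smul_eq_mul, abs_mul,
    Real.mul_iSup_of_nonneg (abs_nonneg c)]

lemma exists_block (b : ℕ → (ℕ →₀ ℝ)) (l j : ℕ) :
    ∃ γ : ℕ →₀ ℝ, fsupNorm γ = 1 ∧ (∀ i < j, γ i = 0) ∧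
      ∀ i < l, Finsupp.linearCombination ℝ b γ i = 0 := by
  let shift : (Fin (l + 1) →₀ ℝ) →ₗ[ℝ] (ℕ →₀ ℝ) := Finsupp.lmapDomain ℝ ℝ fun k => j + (k : ℕ)
  let f : (Fin (l + 1) →₀ ℝ) →ₗ[ℝ] (Fin l → ℝ) :=
    LinearMap.pi fun i => Finsupp.lapply (i : ℕ) ∘ₗ Finsupp.linearCombination ℝ b ∘ₗ shift
  obtain ⟨v, hv, hv0⟩ := Submodule.exists_mem_ne_zero_of_ne_bot
    (LinearMap.ker_ne_bot_of_finrank_lt (f := f) (by simp))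
  have hinj : Function.Injective shift := Finsupp.mapDomain_injective fun k k' h =>
    Fin.ext (Nat.add_left_cancel h)
  have hne : shift v ≠ 0 := fun h => hv0 (hinj (h.trans (map_zero shift).symm))
  have hzero : ∀ i < j, shift v i = 0 := fun i hi => Finsupp.mapDomain_of_notMem_range _ _ (by
    rintro ⟨k, rfl⟩
    exact absurd hi (by simp))
  have hpos : 0 < fsupNorm (shift v) := by
    obtain ⟨i, hi⟩ := Finsupp.ne_iff.1 hne
    exact (abs_pos.2 hi).trans_le (abs_le_fsupNorm _ i)
  refine ⟨(fsupNorm (shift v))⁻¹ • shift v, ?_, fun i hi => by simp [hzero i hi],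
    fun i hi => ?_⟩
  · rw [fsupNorm_smul, abs_of_nonneg (inv_nonneg.2 hpos.le), inv_mul_cancel₀ hpos.ne']
  · have := congrFun (LinearMap.mem_ker.1 hv) ⟨i, hi⟩
    rw [map_smul, Finsupp.smul_apply]
    exact (congrArg _ this).trans (smul_zero _)

lemma restr_eq_self {E : Finset ℕ} {x : ℕ →₀ ℝ} (h : x.support ⊆ E) : restr E x = x := by
  ext i
  rw [restr_apply]
  split_ifs with hi
  · rfl
  · exact (Finsupp.notMem_support_iff.1 fun h' => hi (h h')).symm

lemma restr_eq_zero {E : Finset ℕ} {x : ℕ →₀ ℝ} (h : ∀ i ∈ E, x i = 0) : restr E x = 0 := by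
  ext i
  rw [restr_apply]
  split_ifs with hi
  · exact h i hi
  · rfl

lemma restr_add (E : Finset ℕ) (x y : ℕ →₀ ℝ) : restr E (x + y) = restr E x + restr E y :=
  Finsupp.filter_add

lemma exists_successive_blocks {T : (ℕ →₀ ℝ) → ℝ} {b : ℕ → (ℕ →₀ ℝ)} {c : ℝ}
    (hc : ∀ γ, c * fsupNorm γ ≤ T (Finsupp.linearCombination ℝ b γ)) (n l j : ℕ) :
    ∃ (γ : ℕ →₀ ℝ) (E : Fin n → Finset ℕ), fsupNorm γ ≤ 1 ∧ (∀ i < j, γ i = 0) ∧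
      (∀ i < l, Finsupp.linearCombination ℝ b γ i = 0) ∧ Successive E ∧
      (∀ i, ∀ a ∈ E i, l ≤ a) ∧
      ∀ i, c ≤ T (restr (E i) (Finsupp.linearCombination ℝ b γ)) := by
  induction n generalizing l j with
  | zero => exact ⟨0, fun _ => ∅, by simp, by simp, by simp, fun i => i.elim0, fun i => i.elim0,
      fun i => i.elim0⟩
  | succ n ih =>
    obtain ⟨γ₀, hnorm₀, hj₀, hl₀⟩ := exists_block b l j
    set x₀ := Finsupp.linearCombination ℝ b γ₀ with hx₀
    have hl : ∀ i, x₀ i ≠ 0 → l ≤ i := fun i hi => not_lt.1 fun h => hi (hl₀ i h)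
    have hsup : ∀ (z : ℕ →₀ ℝ) i, z.support.sup id + 1 ≤ i → z i = 0 := fun z i hi => by
      by_contra hne
      have := Finset.le_sup (f := id) (Finsupp.mem_support_iff.2 hne)
      simp only [id] at this
      omega
    obtain ⟨γ, E, hnorm, hj, hl', hE, hEl, hcE⟩ :=
      ih (max l (x₀.support.sup id + 1)) (max j (γ₀.support.sup id + 1))
    refine ⟨γ₀ + γ, Fin.cons x₀.support E, fsupNorm_le fun i => ?_, fun i hi => ?_,
      fun i hi => ?_, ?_, ?_, ?_⟩
    · by_cases hi : γ₀.support.sup id + 1 ≤ i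
      · simpa [hsup γ₀ i hi] using (abs_le_fsupNorm γ i).trans hnorm
      · simpa [hj i (lt_max_of_lt_right (not_le.1 hi))] using
          (abs_le_fsupNorm γ₀ i).trans hnorm₀.le
    · simp [hj₀ i hi, hj i (lt_max_of_lt_left hi)]
    · rw [map_add, Finsupp.add_apply, hl₀ i hi, hl' i (lt_max_of_lt_left hi), add_zero]
    · intro i i' hii' a ha a' ha'
      cases i' using Fin.cases with
      | zero => exact absurd hii' (Fin.not_lt_zero i)
      | succ i' =>
        rw [Fin.cons_succ] at ha'
        cases i using Fin.cases with
        | zero =>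
          rw [Fin.cons_zero] at ha
          exact (Nat.lt_succ_iff.2 (Finset.le_sup (f := id) ha)).trans_le
            ((le_max_right _ _).trans (hEl i' a' ha'))
        | succ i =>
          rw [Fin.cons_succ] at ha
          exact hE i i' (Fin.succ_lt_succ_iff.1 hii') a ha a' ha'
    · refine Fin.cases (fun a ha => ?_) fun i a ha => ?_
      · rw [Fin.cons_zero] at ha
        exact hl a (Finsupp.mem_support_iff.1 ha)
      · rw [Fin.cons_succ] at ha
        exact (le_max_left _ _).trans (hEl i a ha)
    · refine Fin.cases ?_ fun i => ?_
      · rw [Fin.cons_zero, map_add, restr_add, restr_eq_self subset_rfl,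
          restr_eq_zero (x := Finsupp.linearCombination ℝ b γ), add_zero]
        · simpa [hnorm₀] using hc γ₀
        · intro i hi
          exact hl' i (lt_max_of_lt_right (Nat.lt_succ_iff.2 (Finset.le_sup (f := id) hi)))
      · rw [Fin.cons_succ, map_add, restr_add, restr_eq_zero (x := x₀), zero_add]
        · exact hcE i
        · exact fun a ha => hsup x₀ a ((le_max_right _ _).trans (hEl i a ha))

lemma IsT1Norm.not_normContainsC0 {p θ : ℝ} {T : (ℕ →₀ ℝ) → ℝ} (hT : IsT1Norm p θ T)
    (hp : 0 < p) (hθ : 0 < θ) : ¬ NormContainsC0 T := by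
  rintro ⟨b, c, C, hc, hb⟩
  have hcp : 0 < θ * c ^ p := mul_pos hθ (Real.rpow_pos_of_pos hc p)
  obtain ⟨n, hn⟩ := exists_nat_gt (|C| ^ p / (θ * c ^ p))
  rw [div_lt_iff₀ hcp] at hn
  obtain ⟨γ, E, hγ, -, -, hE, hEn, hcE⟩ := exists_successive_blocks (fun γ => (hb γ).1) n n 0
  have hle := hT.sum_le_of_successive hp hθ (Finsupp.linearCombination ℝ b γ) hE hEn
  have hC : T (Finsupp.linearCombination ℝ b γ) ≤ |C| :=
    calc _ ≤ C * fsupNorm γ := (hb γ).2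
      _ ≤ |C| * 1 := mul_le_mul (le_abs_self C) hγ (fsupNorm_nonneg γ) (abs_nonneg C)
      _ = |C| := mul_one _
  have hsum : (n : ℝ) * c ^ p ≤
      ∑ i, T (restr (E i) (Finsupp.linearCombination ℝ b γ)) ^ p := by
    simpa using Finset.card_nsmul_le_sum Finset.univ _ (c ^ p) fun i _ =>
      Real.rpow_le_rpow hc.le (hcE i) hp.le
  have := Real.rpow_le_rpow (IsMixedTsirelsonNorm.nonneg hT _) hC hp.le
  have := mul_le_mul_of_nonneg_left hsum hθ.le
  linarith [mul_left_comm (n : ℝ) θ (c ^ p)]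

end ContainsC0

section Domination

/-- The sets of leaves available at level `s` of a tree of height at most `N`. -/
def leafFamily (N s : ℕ) : Set (Finset ℕ) :=
  {F | F = ∅ ∨ s < N ∧ F ∈ shiftedSchreier (N - s)}

lemma isHereditary_leafFamily (N s : ℕ) : IsHereditary (leafFamily N s) := by
  rintro F (rfl | ⟨hs, hF⟩) G hG
  · exact Or.inl (Finset.subset_empty.1 hG)
  · exact Or.inr ⟨hs, isHereditary_shiftedSchreier _ F hF G hG⟩

lemma Spaced.biUnion_mem_leafFamily {N s n : ℕ} {M : Finset ℕ} (hM : M ∈ SchreierNat n)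
    {F : ℕ → Finset ℕ} (hF : Spaced M F) (hmem : ∀ j ∈ M, F j ∈ leafFamily N (s + n)) :
    M.biUnion F ∈ leafFamily N s := by
  by_cases hs : s + n < N
  · refine Or.inr ⟨by omega, ?_⟩
    rw [show N - s = N - (s + n) + n by omega]
    refine hF.biUnion_mem_shiftedSchreier hM fun j hj => ?_
    obtain h | h := hmem j hj
    · rw [h]
      exact empty_mem_shiftedSchreier _
    · exact h.2
  · refine Or.inl (Finset.eq_empty_of_forall_notMem fun i hi => ?_)
    obtain ⟨j, hj, hi⟩ := Finset.mem_biUnion.1 hi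
    rw [(hmem j hj).resolve_right fun h => hs h.1] at hi
    exact Finset.notMem_empty i hi

variable {p θ δ : ℝ} {w : ℕ → ℝ} {S T : (ℕ →₀ ℝ) → ℝ} {N : ℕ}

lemma card_support_restr_lt {E : Finset ℕ} {x : ℕ →₀ ℝ} (h : ¬ x.support ⊆ E) :
    (restr E x).support.card < x.support.card := by
  refine Finset.card_lt_card (Finset.ssubset_iff_subset_ne.2 ⟨fun i hi => ?_, fun he => h ?_⟩)
  · rw [Finsupp.mem_support_iff, restr_apply] at hi
    exact Finsupp.mem_support_iff.2 fun h0 => hi (by simp [h0])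
  · rw [← he]
    intro i hi
    by_contra hiE
    simp [restr_apply, hiE] at hi

/-- One step of the comparison: if the pieces of an admissible splitting of `x` satisfy the
estimate, so does the splitting. -/
lemma IsT1Norm.le_of_forall_piece (hT : IsT1Norm p θ T) (hp : 0 < p) (hθ : 0 < θ)
    (hsub : ∀ n m, w n * w m ≤ w (n + m)) (hδ : 0 ≤ δ) (hS : ∀ x, 0 ≤ S x) {x : ℕ →₀ ℝ}
    {s n : ℕ} {B : ℝ} (hB : ∀ F ∈ leafFamily N s, T (restr F x) ^ p ≤ B) {M : Finset ℕ}
    (hM : M ∈ SchreierNat n) {D : ℕ → Finset ℕ} (hD : Spaced M D)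
    (hpiece : ∀ j ∈ M, ∀ B', (∀ F ∈ leafFamily N (s + n), T (restr F (restr (D j) x)) ^ p ≤ B') →
      w (s + n) * S (restr (D j) x) ^ p ≤ θ ^ (s + n) * (B' + δ * T (restr (D j) x) ^ p)) :
    w s * (w n * ∑ j ∈ M, S (restr (D j) x) ^ p) ≤ θ ^ s * (B + δ * T x ^ p) := by
  classical
  have hmax : ∀ j, ∃ F ∈ (D j).powerset.filter (· ∈ leafFamily N (s + n)),
      ∀ G ∈ (D j).powerset.filter (· ∈ leafFamily N (s + n)),
        T (restr G x) ^ p ≤ T (restr F x) ^ p := fun j =>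
    Finset.exists_max_image _ _ ⟨∅, Finset.mem_filter.2
      ⟨Finset.empty_mem_powerset _, Or.inl rfl⟩⟩
  choose F hF hFmax using hmax
  have hFD : ∀ j, F j ⊆ D j := fun j => Finset.mem_powerset.1 (Finset.mem_filter.1 (hF j)).1
  have hF' : Spaced M F := hD.mono fun j _ => hFD j
  have hunion := hB _ (hF'.biUnion_mem_leafFamily hM fun j _ => (Finset.mem_filter.1 (hF j)).2)
  have hleaf : θ ^ n * ∑ j ∈ M, T (restr (F j) x) ^ p ≤ B := by
    refine le_trans ?_ hunion
    have := hT.sum_le_of_spaced hp hθ hM hF' (restr (M.biUnion F) x)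
    rwa [Finset.sum_congr rfl fun j hj => by
      rw [restr_restr_of_subset (Finset.subset_biUnion_of_mem F hj)]] at this
  have hrest := hT.sum_le_of_spaced hp hθ hM hD x
  calc w s * (w n * ∑ j ∈ M, S (restr (D j) x) ^ p)
      = ∑ j ∈ M, w s * w n * S (restr (D j) x) ^ p := by rw [← mul_assoc, Finset.mul_sum]
    _ ≤ ∑ j ∈ M, w (s + n) * S (restr (D j) x) ^ p := Finset.sum_le_sum fun j _ =>
        mul_le_mul_of_nonneg_right (hsub s n) (Real.rpow_nonneg (hS _) _)
    _ ≤ ∑ j ∈ M, θ ^ (s + n) * (T (restr (F j) x) ^ p + δ * T (restr (D j) x) ^ p) := by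
        refine Finset.sum_le_sum fun j hj => hpiece j hj _ fun G hG => ?_
        rw [restr_restr]
        refine hFmax j _ (Finset.mem_filter.2
          ⟨Finset.mem_powerset.2 Finset.inter_subset_right, ?_⟩)
        exact isHereditary_leafFamily _ _ G hG _ Finset.inter_subset_left
    _ = θ ^ s * (θ ^ n * ∑ j ∈ M, T (restr (F j) x) ^ p +
          δ * (θ ^ n * ∑ j ∈ M, T (restr (D j) x) ^ p)) := by
        rw [← Finset.mul_sum, Finset.sum_add_distrib, ← Finset.mul_sum]
        ring
    _ ≤ θ ^ s * (B + δ * T x ^ p) := by gcongr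

lemma IsMixedTsirelsonNorm.le_add_of_leafFamily (hS : IsMixedTsirelsonNorm p Set.univ w S)
    (hT : IsT1Norm p θ T) (hp : 0 < p) (hθ : 0 < θ) (hpos : ∀ n, 0 < w n) (hone : w 0 < 1)
    (hanti : Antitone w) (hsub : ∀ n m, w n * w m ≤ w (n + m)) (hwθ : ∀ n, w n ≤ θ ^ n)
    (hδ : 0 ≤ δ) (hN : ∀ n, N ≤ n → w n ≤ δ * θ ^ n) (x : ℕ →₀ ℝ) (s : ℕ) (B : ℝ)
    (hB : ∀ F ∈ leafFamily N s, T (restr F x) ^ p ≤ B) :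
    w s * S x ^ p ≤ θ ^ s * (B + δ * T x ^ p) := by
  induction hcard : x.support.card using Nat.strong_induction_on generalizing x s B with
  | _ d ih =>
  have hSnn := hS.nonneg
  have hTnn : ∀ y, 0 ≤ T y := IsMixedTsirelsonNorm.nonneg hT
  have hTx : 0 ≤ T x ^ p := Real.rpow_nonneg (hTnn x) p
  have hB0 : 0 ≤ B := (Real.rpow_nonneg (hTnn _) p).trans (hB ∅ (Or.inl rfl))
  set V := θ ^ s * (B + δ * T x ^ p) with hV
  have hV0 : 0 ≤ V := by positivity
  have hws := hpos s
  have hleaf : w s * fsupNorm x ^ p ≤ V := by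
    obtain ⟨i, hi⟩ := exists_fsupNorm_eq x
    by_cases hs : s < N
    · have hTi : fsupNorm x ^ p ≤ B := by
        refine (Real.rpow_le_rpow (fsupNorm_nonneg x) ?_ hp.le).trans
          (hB {i} (Or.inr ⟨hs, singleton_mem_shiftedSchreier _ i⟩))
        have := abs_le_fsupNorm (restr {i} x) i
        rw [restr_apply, if_pos (Finset.mem_singleton_self i)] at this
        exact hi.trans_le (this.trans (IsMixedTsirelsonNorm.fsupNorm_le hT _))
      have hmul := mul_le_mul (hwθ s) hTi (Real.rpow_nonneg (fsupNorm_nonneg x) p) (by positivity)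
      have : 0 ≤ θ ^ s * (δ * T x ^ p) := by positivity
      rw [hV]
      linarith
    · have hTi : fsupNorm x ^ p ≤ T x ^ p := Real.rpow_le_rpow (fsupNorm_nonneg x)
        (IsMixedTsirelsonNorm.fsupNorm_le hT x) hp.le
      have hmul := mul_le_mul (hN s (not_lt.1 hs)) hTi
        (Real.rpow_nonneg (fsupNorm_nonneg x) p) (by positivity)
      have : 0 ≤ θ ^ s * B := by positivity
      rw [hV]
      linarith
  set U := max (w 0 * (w s * S x ^ p)) V with hU
  have hU0 : 0 ≤ U := hV0.trans (le_max_right _ _)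
  have hnode : ∀ r ∈ {r : ℝ | ∃ n ∈ (Set.univ : Set ℕ), ∃ (k : ℕ) (E : Fin k → Finset ℕ),
      SAdmissible (SchreierNat n) E ∧
        r = w n ^ (1 / p) * (∑ i, S (restr (E i) x) ^ p) ^ (1 / p)},
      r ≤ (U / w s) ^ (1 / p) := by
    rintro _ ⟨n, -, k, E, hE, rfl⟩
    have hsum : 0 ≤ ∑ i, S (restr (E i) x) ^ p := Finset.sum_nonneg fun i _ =>
      Real.rpow_nonneg (hSnn _) _
    rw [← Real.mul_rpow (hpos n).le hsum]
    refine Real.rpow_le_rpow (mul_nonneg (hpos n).le hsum) ?_ (one_div_pos.2 hp).le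
    rw [le_div_iff₀' hws]
    by_cases hwhole : ∃ i, x.support ⊆ E i
    · obtain ⟨i, hi⟩ := hwhole
      refine le_trans ?_ (le_max_left _ _)
      rw [Finset.sum_eq_single i]
      · rw [restr_eq_self hi, ← mul_assoc, mul_comm (w s), mul_assoc]
        have : 0 ≤ w s * S x ^ p := mul_nonneg hws.le (Real.rpow_nonneg (hSnn x) p)
        exact mul_le_mul_of_nonneg_right (hanti n.zero_le) this
      · intro i' _ hne
        rw [restr_eq_zero fun a ha => ?_, hS.zero hp trivial (hpos 1), Real.zero_rpow hp.ne']
        by_contra ha0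
        exact Finset.disjoint_left.1 (Successive.disjoint hE.2.1 hne) ha
          (hi (Finsupp.mem_support_iff.2 ha0))
      · simp
    · refine le_trans ?_ (le_max_right _ _)
      obtain ⟨M, hM, D, hD, hDE, hsumD⟩ := hE.exists_spaced
      rw [hsumD fun G => S (restr G x) ^ p]
      refine hT.le_of_forall_piece hp hθ hsub hδ hSnn hB hM hD fun j hj B' hB' => ?_
      refine ih _ ?_ _ _ _ hB' rfl
      rw [← hcard]
      obtain ⟨i, hi⟩ := hDE j hj
      exact card_support_restr_lt fun h => hwhole ⟨i, hi ▸ h⟩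
  have hSU : S x = fsupNorm x ∨ S x ≤ (U / w s) ^ (1 / p) := by
    have hle := Real.sSup_le hnode (by positivity)
    rw [hS x]
    obtain h | h := le_total (fsupNorm x) ((U / w s) ^ (1 / p))
    · exact Or.inr (max_le h hle)
    · exact Or.inl (max_eq_left (hle.trans h))
  obtain h | h := hSU
  · rw [h]
    exact hleaf
  · have hpow := Real.rpow_le_rpow (hSnn x) h hp.le
    rw [← Real.rpow_mul (by positivity), one_div_mul_cancel hp.ne', Real.rpow_one,
      le_div_iff₀' hws] at hpow
    obtain h | h := le_max_iff.1 hpow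
    · have h0 : 0 ≤ w s * S x ^ p := mul_nonneg hws.le (Real.rpow_nonneg (hSnn x) p)
      have : w s * S x ^ p ≤ 0 := by nlinarith
      exact this.trans hV0
    · exact h

lemma RegularParams.le_pow (hw : RegularParams w)
    (hθ : Tendsto (fun n : ℕ => w n ^ (1 / (n : ℝ))) atTop (nhds θ)) :
    0 < θ ∧ ∀ n, w n ≤ θ ^ n := by
  obtain ⟨hpos, -, -, hsub⟩ := hw
  have hpow : ∀ n k, w n ^ (k + 1) ≤ w (n * (k + 1)) := by
    intro n k
    induction k with
    | zero => simp
    | succ k ih =>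
      calc w n ^ (k + 1 + 1) = w n ^ (k + 1) * w n := pow_succ _ _
        _ ≤ w (n * (k + 1)) * w n := mul_le_mul_of_nonneg_right ih (hpos n).1.le
        _ ≤ w (n * (k + 1) + n) := hsub _ _
        _ = w (n * (k + 1 + 1)) := by ring_nf
  have hroot : ∀ n, 0 < n → w n ^ (1 / (n : ℝ)) ≤ θ := by
    intro n hn
    have hsubseq : Tendsto (fun k : ℕ => n * (k + 1)) atTop atTop :=
      tendsto_atTop_mono (fun k => (Nat.le_succ k).trans (Nat.le_mul_of_pos_left _ hn)) tendsto_id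
    refine ge_of_tendsto (hθ.comp hsubseq) (Eventually.of_forall fun k => ?_)
    have hn' : (n : ℝ) ≠ 0 := by positivity
    calc w n ^ (1 / (n : ℝ))
        = (w n ^ (k + 1)) ^ (1 / ((n * (k + 1) : ℕ) : ℝ)) := by
          rw [← Real.rpow_natCast, ← Real.rpow_mul (hpos n).1.le]
          congr 1
          push_cast
          field_simp
      _ ≤ _ := Real.rpow_le_rpow (by have := (hpos n).1; positivity) (hpow n k) (by positivity)
  have hθpos : 0 < θ := by
    have := hroot 1 one_pos
    simp only [Nat.cast_one, div_one, Real.rpow_one] at this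
    exact (hpos 1).1.trans_le this
  refine ⟨hθpos, fun n => ?_⟩
  obtain rfl | hn := n.eq_zero_or_pos
  · simpa using (hpos 0).2.le
  · have h := pow_le_pow_left₀ (Real.rpow_nonneg (hpos n).1.le _) (hroot n hn) n
    rwa [one_div, Real.rpow_inv_natCast_pow (hpos n).1.le hn.ne'] at h

end Domination

/-- Let `Z = T^{(p)}[(S_n, θ_n)_{n∈ℕ}]` be a regular
`p`-convexified mixed Tsirelson space with `θ_n/θ^n → 0`, where
`θ = lim_n θ_n^{1/n}`.  Then the unit vector basis of `T^{(p)}_θ` ω-strongly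
dominates the unit vector basis of `Z`. -/
theorem statement6 (p : ℝ) (hp : 1 ≤ p) (θseq : ℕ → ℝ) (hreg : RegularParams θseq)
    (θ : ℝ) (hθ : Tendsto (fun n : ℕ => θseq n ^ (1 / (n : ℝ))) atTop (nhds θ))
    (hratio : Tendsto (fun n : ℕ => θseq n / θ ^ n) atTop (nhds 0))
    (TZ : (ℕ →₀ ℝ) → ℝ) (hTZ : IsMixedTsirelsonNorm p Set.univ θseq TZ)
    (Tθ : (ℕ →₀ ℝ) → ℝ) (hTθ : IsT1Norm p θ Tθ) :
    OmegaStrongDomNorms Tθ TZ := by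
  have hp0 : 0 < p := one_pos.trans_le hp
  obtain ⟨hθ0, hle⟩ := hreg.le_pow hθ
  obtain ⟨hbounds, hanti, -, hsub⟩ := hreg
  have hw0 := (hbounds 0).1
  refine ⟨⟨1, le_rfl, fun a F _ => by simpa using hTθ.restr_le hp0 hθ0 F a⟩,
    hTθ.not_normContainsC0 hp0 hθ0, shiftedSchreier, goodScale_shiftedSchreier,
    fun ε hε => ?_⟩
  set δ : ℝ := θseq 0 * ε ^ p / 2 with hδ
  have hδ0 : 0 < δ := by positivity
  obtain ⟨N, hN⟩ := eventually_atTop.1 (hratio.eventually_le_const hδ0)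
  have hhalf : Tendsto (fun n : ℕ => (1 / 2 : ℝ) ^ n) atTop (nhds 0) :=
    tendsto_pow_atTop_nhds_zero_of_lt_one (by norm_num) (by norm_num)
  obtain ⟨n₀, hn₀⟩ := eventually_atTop.1 (hhalf.eventually_le_const hδ0)
  refine ⟨max N n₀, fun n hn a hsmall hone => ?_⟩
  have hTnn : ∀ y, 0 ≤ Tθ y := IsMixedTsirelsonNorm.nonneg hTθ
  have hB : ∀ F ∈ leafFamily N 0, Tθ (restr F a) ^ p ≤ δ := by
    intro F hF
    have hF' : F ∈ shiftedSchreier n := by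
      obtain rfl | hF := hF
      · exact empty_mem_shiftedSchreier n
      · exact shiftedSchreier_mono ((le_max_left _ _).trans hn) hF.2
    calc Tθ (restr F a) ^ p ≤ ((1 / 2 : ℝ) ^ n) ^ p :=
          Real.rpow_le_rpow (hTnn _) (hsmall F hF') hp0.le
      _ ≤ (1 / 2 : ℝ) ^ n := Real.rpow_le_self_of_le_one (by positivity)
          (pow_le_one₀ (by norm_num) (by norm_num)) hp
      _ ≤ δ := hn₀ n ((le_max_right _ _).trans hn)
  have hmain := hTZ.le_add_of_leafFamily hTθ hp0 hθ0 (fun m => (hbounds m).1) (hbounds 0).2 hanti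
    hsub hle hδ0.le (fun m hm => (div_le_iff₀ (pow_pos hθ0 m)).1 (hN m hm)) a 0 δ hB
  have hTa : Tθ a ^ p ≤ 1 := Real.rpow_le_one (hTnn a) hone hp0.le
  have hfinal : TZ a ^ p ≤ ε ^ p := by
    refine le_of_mul_le_mul_left ?_ hw0
    rw [pow_zero, one_mul] at hmain
    nlinarith
  exact (Real.rpow_le_rpow_iff (hTZ.nonneg a) hε.le hp0).1 hfinal
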